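/- Let β ∈ ℝ^d and let d̄ ∈ ℝ^d have nonnegative entries. Then the infimum over all w₁, w₂ ∈ ℝ^d satisfying w₁ ∘ w₁ − w₂ ∘ w₂ = β of Σ_{k=1}^d d̄_k((w₁)_k² + (w₂)_k²) equals Σ_{k=1}^d d̄_k|β_k|, and it is attained. Consequently, minimizing (1/2n)‖y − X(w₁∘w₁ − w₂∘w₂)‖₂² + 2σ² Σ_k d̄_k((w₁)_k² + (w₂)_k²) over (w₁,w₂) ∈ ℝ^{2d} is equivalent to minimizing the Lasso objective (1/2n)‖y − Xβ‖₂² + 2σ² Σ_k d̄_k|β_k| over β ∈ ℝ^d: the two infima are equal. -/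

import Mathlib

open Matrix

/-- Variational characterization of the weighted `ℓ₁`-norm: the infimum of
`∑_k d̄_k((w₁)_k² + (w₂)_k²)` over `w₁ ∘ w₁ - w₂ ∘ w₂ = β` equals `∑_k d̄_k |β_k|`, and is
attained; consequently the noise-injected diagonal-network objective and the Lasso objective
have the same infimum. -/
theorem diagonal_network_lasso_equivalence
    (n d : ℕ) (X : Matrix (Fin n) (Fin d) ℝ) (y : Fin n → ℝ)
    (dbar : Fin d → ℝ) (hdbar : ∀ k, 0 ≤ dbar k)
    (β : Fin d → ℝ) (σ : ℝ) (hσ : 0 < σ) :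
    (sInf {r : ℝ | ∃ w₁ w₂ : Fin d → ℝ,
        (∀ k, w₁ k * w₁ k - w₂ k * w₂ k = β k) ∧
        r = ∑ k, dbar k * ((w₁ k) ^ 2 + (w₂ k) ^ 2)}
      = ∑ k, dbar k * |β k|) ∧
    (∃ w₁ w₂ : Fin d → ℝ,
        (∀ k, w₁ k * w₁ k - w₂ k * w₂ k = β k) ∧
        ∑ k, dbar k * ((w₁ k) ^ 2 + (w₂ k) ^ 2) = ∑ k, dbar k * |β k|) ∧
    (sInf {r : ℝ | ∃ w₁ w₂ : Fin d → ℝ,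
        r = (1 / (2 * (n : ℝ))) *
              (∑ i, (y i - (X.mulVec fun k => w₁ k * w₁ k - w₂ k * w₂ k) i) ^ 2)
            + 2 * σ ^ 2 * ∑ k, dbar k * ((w₁ k) ^ 2 + (w₂ k) ^ 2)}
      = sInf {r : ℝ | ∃ b : Fin d → ℝ,
        r = (1 / (2 * (n : ℝ))) * (∑ i, (y i - X.mulVec b i) ^ 2)
            + 2 * σ ^ 2 * ∑ k, dbar k * |b k|}) := by
  have att : ∀ b : Fin d → ℝ, ∃ w₁ w₂ : Fin d → ℝ,
      (∀ k, w₁ k * w₁ k - w₂ k * w₂ k = b k) ∧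
      ∑ k, dbar k * ((w₁ k) ^ 2 + (w₂ k) ^ 2) = ∑ k, dbar k * |b k| := by
    intro b
    have h1 : ∀ k, Real.sqrt (max (b k) 0) ^ 2 = max (b k) 0 :=
      fun k => Real.sq_sqrt (le_max_right _ _)
    have h2 : ∀ k, Real.sqrt (max (-b k) 0) ^ 2 = max (-b k) 0 :=
      fun k => Real.sq_sqrt (le_max_right _ _)
    refine ⟨fun k => Real.sqrt (max (b k) 0), fun k => Real.sqrt (max (-b k) 0), ?_, ?_⟩
    · intro k
      simp only [← pow_two, h1, h2]
      rcases le_total (b k) 0 with h | h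
      · rw [max_eq_right h, max_eq_left (by linarith)]; ring
      · rw [max_eq_left h, max_eq_right (by linarith)]; ring
    · refine Finset.sum_congr rfl fun k _ => ?_
      simp only [h1, h2]
      rcases le_total (b k) 0 with h | h
      · rw [max_eq_right h, max_eq_left (by linarith), abs_of_nonpos h]; ring
      · rw [max_eq_left h, max_eq_right (by linarith), abs_of_nonneg h]; ring
  have low : ∀ w₁ w₂ : Fin d → ℝ, ∑ k, dbar k * |w₁ k * w₁ k - w₂ k * w₂ k| ≤
      ∑ k, dbar k * ((w₁ k) ^ 2 + (w₂ k) ^ 2) := by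
    intro w₁ w₂
    refine Finset.sum_le_sum fun k _ => mul_le_mul_of_nonneg_left ?_ (hdbar k)
    rw [abs_le]
    constructor <;> nlinarith [sq_nonneg (w₁ k), sq_nonneg (w₂ k)]
  have hs : 0 ≤ 2 * σ ^ 2 := by positivity
  refine ⟨?_, att β, ?_⟩
  · apply IsLeast.csInf_eq
    constructor
    · obtain ⟨w₁, w₂, h, h'⟩ := att β
      exact ⟨w₁, w₂, h, h'.symm⟩
    · rintro r ⟨w₁, w₂, h, rfl⟩
      have := low w₁ w₂
      simpa only [h] using this
  · apply le_antisymm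
    · refine le_csInf ⟨_, 0, rfl⟩ ?_
      rintro r ⟨b, rfl⟩
      obtain ⟨w₁, w₂, h, h'⟩ := att b
      refine csInf_le ⟨0, ?_⟩ ⟨w₁, w₂, ?_⟩
      · rintro r ⟨w₁, w₂, rfl⟩
        have : 0 ≤ ∑ k, dbar k * ((w₁ k) ^ 2 + (w₂ k) ^ 2) :=
          Finset.sum_nonneg fun k _ => mul_nonneg (hdbar k) (by positivity)
        positivity
      · rw [h']
        simp only [h]
    · refine le_csInf ⟨_, 0, 0, rfl⟩ ?_
      rintro r ⟨w₁, w₂, rfl⟩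
      refine le_trans (csInf_le ⟨0, ?_⟩ ⟨fun k => w₁ k * w₁ k - w₂ k * w₂ k, rfl⟩) ?_
      · rintro r ⟨b, rfl⟩
        have : 0 ≤ ∑ k, dbar k * |b k| :=
          Finset.sum_nonneg fun k _ => mul_nonneg (hdbar k) (abs_nonneg _)
        positivity
      · have := mul_le_mul_of_nonneg_left (low w₁ w₂) hs
        linarith
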